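/- Let U = (a,b) × (c,d) be a bounded open rectangle in ℝ². Suppose g : ℝ² → ℝ is smooth, the (compact) support of g is contained in U, and the integral of g over ℝ² with respect to Lebesgue measure is zero. Then there exist smooth functions P, Q : ℝ² → ℝ whose supports are compact and contained in U, such that (∂Q/∂x)(z) − (∂P/∂y)(z) = g(z) for every z ∈ ℝ². (Compactly supported form of the 'Poincaré lemma with boundary condition' used in the reduction of Theorem 3 to Theorem 1: a compactly supported 2-form of total integral zero on a rectangle is the exterior derivative of a compactly supported 1-form.) -/

import Mathlib

open MeasureTheory

/-- The primitive in the second variable of a smooth function, integrated from `-∞`, is smooth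
provided the function vanishes when its second variable leaves a compact interval. -/
theorem contDiff_integral_Iic {k : ℝ × ℝ → ℝ} {c d : ℝ} (hk : ContDiff ℝ (⊤ : ℕ∞) k)
    (hsupp : ∀ x y, y ∉ Set.Icc c d → k (x, y) = 0) :
    ContDiff ℝ (⊤ : ℕ∞) (fun z : ℝ × ℝ => ∫ s in Set.Iic z.2, k (z.1, s)) := by
  have hloc : LocallyIntegrable (Set.indicator (Set.Ici (0 : ℝ)) (fun _ => (1 : ℝ))) volume :=
    (locallyIntegrable_const 1).indicator measurableSet_Ici
  have h := contDiffOn_convolution_right_with_param (𝕜 := ℝ) (n := ⊤) (μ := volume)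
    (g := fun x y => k (x, y)) (ContinuousLinearMap.mul ℝ ℝ) isOpen_univ isCompact_Icc
    (fun x y _ hy => hsupp x y hy) hloc hk.contDiffOn
  rw [Set.univ_prod_univ, contDiffOn_univ] at h
  convert! h using 2 with z
  rw [convolution_mul_swap, ← integral_indicator measurableSet_Iic]
  congr 1 with s
  simp only [Set.indicator_apply, Set.mem_Iic, Set.mem_Ici, sub_nonneg, ite_mul, one_mul, zero_mul]

theorem integrable_section {k : ℝ × ℝ → ℝ} {c d : ℝ} (hk : Continuous k)
    (hsupp : ∀ x y, y ∉ Set.Icc c d → k (x, y) = 0) (x : ℝ) :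
    Integrable (fun s => k (x, s)) :=
  Continuous.integrable_of_hasCompactSupport (by fun_prop)
    (HasCompactSupport.intro isCompact_Icc (hsupp x))

theorem setIntegral_Iic_eq_integral {f : ℝ → ℝ} {c d y : ℝ} (hy : d ≤ y)
    (hf : ∀ s, s ∉ Set.Icc c d → f s = 0) : ∫ s in Set.Iic y, f s = ∫ s, f s :=
  setIntegral_eq_integral_of_forall_compl_eq_zero fun s hs =>
    hf s fun h => hs (h.2.trans hy)

/-- A smooth function supported in a closed rectangle whose integrals along all vertical lines
vanish is the vertical derivative of a smooth function supported in the same rectangle. -/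
theorem exists_vertical_primitive {k : ℝ × ℝ → ℝ} {a b c d : ℝ} (hk : ContDiff ℝ (⊤ : ℕ∞) k)
    (hsupp : Function.support k ⊆ Set.Icc a b ×ˢ Set.Icc c d)
    (hint : ∀ x, ∫ s, k (x, s) = 0) :
    ∃ P : ℝ × ℝ → ℝ, ContDiff ℝ (⊤ : ℕ∞) P ∧
      Function.support P ⊆ Set.Icc a b ×ˢ Set.Icc c d ∧
      ∀ z, fderiv ℝ P z (0, 1) = k z := by
  have hzero : ∀ x y, (x, y) ∉ Set.Icc a b ×ˢ Set.Icc c d → k (x, y) = 0 := fun x y h =>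
    Function.notMem_support.1 fun h' => h (hsupp h')
  have hzero_snd : ∀ x y, y ∉ Set.Icc c d → k (x, y) = 0 := fun x y h =>
    hzero x y fun h' => h h'.2
  have hP := contDiff_integral_Iic hk hzero_snd
  refine ⟨fun z => ∫ s in Set.Iic z.2, k (z.1, s), hP, ?_, ?_⟩
  · rintro ⟨x, y⟩ hxy
    by_contra hmem
    refine hxy ?_
    rcases lt_or_ge y c with hyc | hyc
    · exact setIntegral_eq_zero_of_forall_eq_zero fun s hs =>
        hzero_snd x s fun h => (hs.trans_lt hyc).not_ge h.1
    rcases le_or_gt d y with hyd | hyd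
    · exact (setIntegral_Iic_eq_integral hyd (hzero_snd x)).trans (hint x)
    · exact setIntegral_eq_zero_of_forall_eq_zero fun s _ =>
        hzero x s fun h => hmem ⟨h.1, hyc, hyd.le⟩
  · rintro ⟨x, y⟩
    have hcont : Continuous fun s => k (x, s) := by have := hk.continuous; fun_prop
    have hi := integrable_section hk.continuous hzero_snd x
    have h₁ : HasDerivAt (fun t => ∫ s in Set.Iic t, k (x, s)) (k (x, y)) y := by
      have h := ((hcont.integral_hasStrictDerivAt 0 y).hasDerivAt).const_add
        (∫ s in Set.Iic (0 : ℝ), k (x, s))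
      refine h.congr_of_eventuallyEq (Filter.Eventually.of_forall fun t => ?_)
      beta_reduce
      rw [← intervalIntegral.integral_Iic_sub_Iic hi.integrableOn hi.integrableOn]
      simp
    have h₂ := (hP.differentiable (by simp) (x, y)).hasFDerivAt.comp_hasDerivAt y
      ((hasDerivAt_const y x).prodMk (hasDerivAt_id y))
    exact h₂.unique h₁

theorem IsCompact.exists_subset_Icc_of_subset_Ioo {S : Set ℝ} {a b : ℝ} (hS : IsCompact S)
    (h : S ⊆ Set.Ioo a b) : ∃ a' b', a < a' ∧ b' < b ∧ S ⊆ Set.Icc a' b' := by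
  rcases S.eq_empty_or_nonempty with rfl | hne
  · exact ⟨a + 1, b - 1, by linarith, by linarith, Set.empty_subset _⟩
  · obtain ⟨x, hx⟩ := hS.exists_isLeast hne
    obtain ⟨y, hy⟩ := hS.exists_isGreatest hne
    exact ⟨x, y, (h hx.1).1, (h hy.1).2, fun s hs => ⟨hx.2 hs, hy.2 hs⟩⟩

theorem exists_contDiff_integral_eq_one {c d : ℝ} (hcd : c < d) :
    ∃ φ : ℝ → ℝ, ContDiff ℝ (⊤ : ℕ∞) φ ∧ HasCompactSupport φ ∧ tsupport φ ⊆ Set.Ioo c d ∧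
      ∫ s, φ s = 1 := by
  let f : ContDiffBump ((c + d) / 2) :=
    ⟨(d - c) / 8, (d - c) / 4, by linarith, by linarith⟩
  refine ⟨f.normed volume, f.contDiff_normed, f.hasCompactSupport_normed, ?_, f.integral_normed⟩
  rw [f.tsupport_normed_eq, Real.closedBall_eq_Icc]
  have hr : f.rOut = (d - c) / 4 := rfl
  exact Set.Icc_subset_Ioo (by linarith) (by linarith)


/-- Compactly supported Poincaré lemma on a bounded open rectangle
`U = (a,b) × (c,d)`: a smooth function `g` (the coefficient of a 2-form) with
compact support contained in `U` and total Lebesgue integral zero is the curl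
`∂Q/∂x − ∂P/∂y` of a pair of smooth functions `P, Q` (the components of a 1-form
`β = P dx + Q dy`) whose supports are compact and contained in `U`. -/
theorem poincare_lemma_compact_support
    (a b c d : ℝ)
    (g : ℝ × ℝ → ℝ) (hg : ContDiff ℝ (⊤ : ℕ∞) g)
    (hg_supp_compact : HasCompactSupport g)
    (hg_supp : tsupport g ⊆ Set.Ioo a b ×ˢ Set.Ioo c d)
    (hg_int : ∫ z, g z = 0) :
    ∃ P Q : ℝ × ℝ → ℝ,
      ContDiff ℝ (⊤ : ℕ∞) P ∧ ContDiff ℝ (⊤ : ℕ∞) Q ∧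
      HasCompactSupport P ∧ HasCompactSupport Q ∧
      tsupport P ⊆ Set.Ioo a b ×ˢ Set.Ioo c d ∧
      tsupport Q ⊆ Set.Ioo a b ×ˢ Set.Ioo c d ∧
      (∀ z : ℝ × ℝ, fderiv ℝ Q z (1, 0) - fderiv ℝ P z (0, 1) = g z) := by
  rcases eq_or_ne g 0 with rfl | hg_ne
  · refine ⟨0, 0, contDiff_const, contDiff_const, .zero, .zero, ?_, ?_, ?_⟩ <;> simp
  obtain ⟨z₀, hz₀⟩ := Function.ne_iff.1 hg_ne
  have hcd : c < d := by
    have h := (hg_supp (subset_tsupport g hz₀)).2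
    exact h.1.trans h.2
  obtain ⟨φ, hφ, hφc, hφs, hφi⟩ := exists_contDiff_integral_eq_one hcd
  obtain ⟨a', b', ha, hb, hab⟩ :=
    (hg_supp_compact.image continuous_fst).exists_subset_Icc_of_subset_Ioo
    (Set.image_subset_iff.2 fun z hz => (hg_supp hz).1)
  obtain ⟨c', d', hc, hd, hcd'⟩ :=
    ((hg_supp_compact.image continuous_snd).union hφc).exists_subset_Icc_of_subset_Ioo
    (Set.union_subset (Set.image_subset_iff.2 fun z hz => (hg_supp hz).2) hφs)
  have hgR : Function.support g ⊆ Set.Icc a' b' ×ˢ Set.Icc c' d' := fun z hz =>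
    ⟨hab ⟨z, subset_tsupport g hz, rfl⟩, hcd' (Or.inl ⟨z, subset_tsupport g hz, rfl⟩)⟩
  have hφR : Function.support φ ⊆ Set.Icc c' d' := fun s hs => hcd' (Or.inr (subset_tsupport φ hs))
  have hRU : Set.Icc a' b' ×ˢ Set.Icc c' d' ⊆ Set.Ioo a b ×ˢ Set.Ioo c d :=
    Set.prod_mono (Set.Icc_subset_Ioo ha hb) (Set.Icc_subset_Ioo hc hd)
  have hg_snd : ∀ x y, y ∉ Set.Icc c' d' → g (x, y) = 0 := fun x y h =>
    Function.notMem_support.1 fun h' => h (hgR h').2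
  set G : ℝ → ℝ := fun x => ∫ s, g (x, s)
  have hG : ContDiff ℝ (⊤ : ℕ∞) G := by
    have h := (contDiff_integral_Iic hg hg_snd).comp
      (contDiff_id.prodMk (contDiff_const (c := d')))
    convert! h using 1
    ext x
    exact (setIntegral_Iic_eq_integral le_rfl (hg_snd x)).symm
  have hGR : Function.support G ⊆ Set.Icc a' b' := by
    intro x hx
    by_contra h
    refine hx (integral_eq_zero_of_ae (Filter.Eventually.of_forall fun s => ?_))
    exact Function.notMem_support.1 fun h' => h (hgR h').1
  have hGi : ∫ x, G x = 0 := by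
    rw [← hg_int, Measure.volume_eq_prod, integral_prod]
    exact hg.continuous.integrable_of_hasCompactSupport hg_supp_compact
  obtain ⟨P, hP, hPR, hPd⟩ := exists_vertical_primitive
    (k := fun z => φ z.2 * G z.1 - g z) (a := a') (b := b') (c := c') (d := d')
    (((hφ.comp contDiff_snd).mul (hG.comp contDiff_fst)).sub hg)
    (by
      intro z hz
      by_contra h
      refine hz ?_
      have h₁ : g z = 0 := Function.notMem_support.1 fun h' => h (hgR h')
      have h₂ : φ z.2 * G z.1 = 0 := by
        by_contra h'
        exact h ⟨hGR (right_ne_zero_of_mul h'), hφR (left_ne_zero_of_mul h')⟩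
      simp [h₁, h₂])
    (by
      intro x
      dsimp only
      rw [integral_sub ((hφ.continuous.integrable_of_hasCompactSupport hφc).mul_const _)
        (integrable_section hg.continuous hg_snd x), integral_mul_const, hφi, one_mul]
      exact sub_self _)
  obtain ⟨Q, hQ, hQR, hQd⟩ := exists_vertical_primitive
    (k := fun z => φ z.1 * G z.2) (a := c') (b := d') (c := a') (d := b')
    ((hφ.comp contDiff_fst).mul (hG.comp contDiff_snd))
    (fun z hz => ⟨hφR (left_ne_zero_of_mul hz), hGR (right_ne_zero_of_mul hz)⟩)
    (fun y => by simp only [integral_const_mul, hGi, mul_zero])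
  have hQR' : Function.support (fun z => Q z.swap) ⊆ Set.Icc a' b' ×ˢ Set.Icc c' d' :=
    fun z hz => ⟨(hQR hz).2, (hQR hz).1⟩
  have hR : IsCompact (Set.Icc a' b' ×ˢ Set.Icc c' d') := isCompact_Icc.prod isCompact_Icc
  refine ⟨P, fun z => Q z.swap, hP, hQ.comp (contDiff_snd.prodMk contDiff_fst),
    .of_support_subset_isCompact hR hPR, .of_support_subset_isCompact hR hQR',
    (closure_minimal hPR hR.isClosed).trans hRU, (closure_minimal hQR' hR.isClosed).trans hRU,
    fun z => ?_⟩
  have hswap : fderiv ℝ (fun z : ℝ × ℝ => Q z.swap) z (1, 0) = fderiv ℝ Q z.swap (0, 1) := by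
    have h := (ContinuousLinearEquiv.prodComm ℝ ℝ ℝ).comp_right_fderiv (f := Q) (x := z)
    exact DFunLike.congr_fun h (1, 0)
  rw [hswap, hQd, hPd]
  simp
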